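/- Let p ∈ T lie on the horizontal Δ-line from P = (0,0) to Q = (φ, 0), with p not in the R₀-orbit of 0. Set α = 2−φ and ρ = dist(p, P)/φ. Then {n ∈ ℤ² : R₀ⁿ(p) ∈ Δ} = (M·H_{α,ρ} + S₀) ∪ (M·V_{α,ρ} + S₀), where M is the integer matrix with rows (1, 0) and (0, 0), and S₀ = {(0,0),(0,1)}. -/

import Mathlib

noncomputable section

namespace JeandelRao

/-- The golden ratio. -/
def φ : ℝ := (1 + Real.sqrt 5) / 2

/-- The lattice Γ₀ generated by (φ,0) and (1,φ+3). -/
def Γ₀ : AddSubgroup (ℝ × ℝ) := AddSubgroup.closure {(φ, 0), (1, φ + 3)}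

/-- The torus T = ℝ²/Γ₀. -/
abbrev T : Type := (ℝ × ℝ) ⧸ Γ₀

/-- The canonical projection ℝ² → ℝ²/Γ₀. -/
def π : ℝ × ℝ → T := QuotientAddGroup.mk

/-- The canonical embedding of ℤ² into ℝ². -/
def ι (n : ℤ × ℤ) : ℝ × ℝ := ((n.1 : ℝ), (n.2 : ℝ))

/-- The ℤ²-rotation action R₀ⁿ(x) = x + n on the torus T. -/
def R₀ (n : ℤ × ℤ) (x : T) : T := x + π (ι n)

/-- The endpoints of the Δ-lines: the boundary Δ = ⋃ₐ ∂Pₐ of Labbé's polygonal partition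
P₀ = {P₀,…,P₁₀} of T is the union of these closed line segments, each of slope
0, φ, φ² or ∞. -/
def ΔLines : List ((ℝ × ℝ) × (ℝ × ℝ)) :=
  [ -- slope 0
    ((0, 0), (φ, 0)), ((0, 1), (φ, 1)),
    -- slope φ
    ((0, 0), (φ - 1, 1)), ((1, 0), (φ, 1)),
    ((0, 1), (φ - 1, 2)), ((φ - 1, 2), (2*φ - 2, 3)), ((2*φ - 2, 3), (φ, φ + 2)),
    ((1, 1), (φ, 2)),
    ((0, 2), (φ - 1, 3)), ((φ - 1, 3), (1, φ + 2)), ((1, φ + 2), (2*φ - 2, 4)),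
    ((2*φ - 2, 4), (φ, φ + 3)),
    ((0, φ + 1), (2*φ - 3, 3)), ((2*φ - 3, 3), (φ - 1, φ + 2)),
    ((2 - φ, φ + 2), (φ - 1, 4)),
    -- slope φ²
    ((φ - 1, 0), (1, 1)),
    ((0, 1), (2 - φ, 2)), ((2 - φ, 2), (4 - 2*φ, 3)), ((4 - 2*φ, 3), (1, φ + 2)),
    ((φ - 1, 1), (1, 2)), ((1, 2), (3 - φ, 3)), ((3 - φ, 3), (φ, φ + 2)),
    ((0, 2), (2 - φ, 3)), ((2 - φ, 3), (4 - 2*φ, 4)), ((4 - 2*φ, 4), (1, φ + 3)),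
    ((0, φ + 2), (5 - 3*φ, 4)), ((5 - 3*φ, 4), (2 - φ, φ + 3)),
    -- slope ∞
    ((0, 0), (0, 1)), ((0, 1), (0, 2)), ((0, 2), (0, 3)), ((0, 3), (0, 4)),
    ((0, 4), (0, φ + 3)),
    ((2 - φ, φ + 2), (2 - φ, 4)), ((2 - φ, 4), (2 - φ, φ + 3)),
    ((φ - 1, 0), (φ - 1, 1)), ((φ - 1, 1), (φ - 1, 2)),
    ((1, 0), (1, 1)), ((1, 1), (1, 2)),
    ((1, φ + 1), (1, 3)), ((1, 3), (1, 4)), ((1, 4), (1, φ + 3)) ]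

/-- The boundary Δ ⊆ ℝ² of the partition P₀ (as a subset of a fundamental domain of T),
i.e. the union of the Δ-lines. -/
def Δ : Set (ℝ × ℝ) := {x | ∃ pq ∈ ΔLines, x ∈ segment ℝ pq.1 pq.2}


/-- The lower mechanical word of slope α and intercept ρ:
s_{α,ρ}(n) = ⌊α(n+1)+ρ⌋ − ⌊αn+ρ⌋. -/
def mech (α ρ : ℝ) (n : ℤ) : ℤ := ⌊α * (n + 1) + ρ⌋ - ⌊α * n + ρ⌋

/-- H_{α,ρ}: the starting points (n, ⌊αn+ρ⌋) of the horizontal steps of the lower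
mechanical line of slope α and intercept ρ. -/
def Hset (α ρ : ℝ) : Set (ℤ × ℤ) :=
  {m | m.2 = ⌊α * m.1 + ρ⌋ ∧ mech α ρ m.1 = 0}

/-- V_{α,ρ}: the starting points (n, ⌊αn+ρ⌋) of the diagonal steps of the lower
mechanical line of slope α and intercept ρ. -/
def Vset (α ρ : ℝ) : Set (ℤ × ℤ) :=
  {m | m.2 = ⌊α * m.1 + ρ⌋ ∧ mech α ρ m.1 = 1}

/-- The support of the pattern B₀. -/
def suppB₀ : Set (ℤ × ℤ) := {(0,0),(0,1)}

/-- The support of the pattern G₀. -/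
def suppG₀ : Set (ℤ × ℤ) := {(0,0),(0,1)}

theorem φ_eq_goldenRatio : φ = Real.goldenRatio := rfl

theorem φ_pos : 0 < φ := Real.goldenRatio_pos

theorem φ_sq : φ ^ 2 = φ + 1 := Real.goldenRatio_sq

theorem int_combination_φ_eq_zero {a b : ℤ} (h : (a : ℝ) + b * φ = 0) : a = 0 ∧ b = 0 := by
  have hb : b = 0 := by
    by_contra hb
    exact ((Real.goldenRatio_irrational.intCast_mul hb).intCast_add a).ne_zero h
  subst hb
  exact ⟨by simpa using h, rfl⟩

/-- The subring ℤ[φ] of ℝ. -/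
def intAdjoinφ : Subring ℝ := (Algebra.adjoin ℤ {φ}).toSubring

theorem φ_mem : φ ∈ intAdjoinφ := Algebra.subset_adjoin (Set.mem_singleton φ)

theorem exists_int_combination {r : ℝ} (hr : r ∈ intAdjoinφ) : ∃ a b : ℤ, r = a + b * φ := by
  refine Algebra.adjoin_induction (p := fun r _ => ∃ a b : ℤ, r = a + b * φ)
    ?_ ?_ ?_ ?_ hr
  · rintro x rfl
    exact ⟨0, 1, by simp⟩
  · intro a
    exact ⟨a, 0, by simp⟩
  · rintro _ _ _ _ ⟨a, b, rfl⟩ ⟨c, d, rfl⟩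
    exact ⟨a + c, b + d, by push_cast; ring⟩
  · rintro _ _ _ _ ⟨a, b, rfl⟩ ⟨c, d, rfl⟩
    refine ⟨a * c + b * d, a * d + b * c + b * d, ?_⟩
    push_cast
    linear_combination (b * d : ℝ) * φ_sq

theorem int_combination_mem (a b : ℤ) : (a + b * φ : ℝ) ∈ intAdjoinφ :=
  add_mem (intCast_mem _ a) (mul_mem (intCast_mem _ b) φ_mem)

theorem mem_Γ₀_iff {v : ℝ × ℝ} :
    v ∈ Γ₀ ↔ ∃ a b : ℤ, v = (a * φ + b, b * (φ + 3)) := by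
  simp only [Γ₀, AddSubgroup.mem_closure_pair, Prod.smul_mk, Prod.mk_add_mk, zsmul_eq_mul]
  refine exists₂_congr fun a b => ?_
  rw [eq_comm]
  simp

theorem π_eq_π_iff {u v : ℝ × ℝ} :
    π u = π v ↔ ∃ a b : ℤ, v = u + (a * φ + b, b * (φ + 3)) := by
  rw [π, QuotientAddGroup.eq, mem_Γ₀_iff]
  simp only [neg_add_eq_iff_eq_add]

theorem R₀_π (n : ℤ × ℤ) (v : ℝ × ℝ) : R₀ n (π v) = π (v + ι n) := rfl

/-- A Δ-line is one of the two horizontal ones, or it starts in ℤ[φ]² and its inverse slope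
lies in ℤ[φ]. -/
theorem ΔLines_horizontal_or_inverse_slope_mem (pq : (ℝ × ℝ) × (ℝ × ℝ)) (h : pq ∈ ΔLines) :
    (pq = ((0, 0), (φ, 0)) ∨ pq = ((0, 1), (φ, 1))) ∨
      pq.1.1 ∈ intAdjoinφ ∧ pq.1.2 ∈ intAdjoinφ ∧
        ∃ c ∈ intAdjoinφ, pq.2.1 - pq.1.1 = c * (pq.2.2 - pq.1.2) := by
  have hφ := φ_mem
  have hn (n : ℕ) [n.AtLeastTwo] : (ofNat(n) : ℝ) ∈ intAdjoinφ := ofNat_mem _ n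
  have h1 := one_mem intAdjoinφ
  have h0 := zero_mem intAdjoinφ
  have hsq := φ_sq
  revert pq
  rw [ΔLines, List.forall_mem_cons, List.forall_mem_cons]
  refine ⟨.inl (.inl rfl), .inl (.inr rfl), ?_⟩
  simp only [List.forall_mem_cons, List.not_mem_nil,
    IsEmpty.forall_iff, implies_true, and_true]
  split_ands
  all_goals
    refine .inr ⟨?_, ?_, ?_⟩
    · apply_rules [add_mem, neg_mem, mul_mem]
    · apply_rules [add_mem, neg_mem, mul_mem]
    · first
      | exact ⟨0, h0, by ring1⟩
      | exact ⟨φ - 1, sub_mem hφ h1, by grind⟩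
      | exact ⟨2 - φ, sub_mem (hn 2) hφ, by grind⟩

/-- A point of Δ whose ordinate is in ℤ[φ] but whose abscissa is not lies on one of the two
horizontal Δ-lines. -/
theorem snd_eq_zero_or_one_of_mem_Δ {v : ℝ × ℝ} (hv : v ∈ Δ) (h₁ : v.1 ∉ intAdjoinφ)
    (h₂ : v.2 ∈ intAdjoinφ) : v.2 = 0 ∨ v.2 = 1 := by
  obtain ⟨pq, hpq, hseg⟩ := hv
  rw [segment_eq_image'] at hseg
  obtain ⟨t, -, rfl⟩ := hseg
  rcases ΔLines_horizontal_or_inverse_slope_mem pq hpq with (rfl | rfl) | ⟨hx, hy, c, hc, hcs⟩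
  · simp
  · simp
  · refine absurd ?_ h₁
    have key : (pq.1 + t • (pq.2 - pq.1)).1 =
        pq.1.1 + c * ((pq.1 + t • (pq.2 - pq.1)).2 - pq.1.2) := by
      simp only [Prod.fst_add, Prod.snd_add, Prod.smul_fst, Prod.smul_snd, Prod.fst_sub,
        Prod.snd_sub, smul_eq_mul]
      linear_combination t * hcs
    rw [key]
    exact add_mem hx (mul_mem hc (sub_mem h₂ hy))

theorem π_mem_image_Δ_of_horizontal (x : ℝ) {y : ℝ} (hy : ((0, y), (φ, y)) ∈ ΔLines) :
    π (x, y) ∈ π '' Δ := by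
  set k := ⌊x / φ⌋ with hk
  have hlo : k * φ ≤ x := (le_div_iff₀ φ_pos).1 (Int.floor_le _)
  have hhi : x ≤ (k + 1) * φ := ((div_lt_iff₀ φ_pos).1 (Int.lt_floor_add_one _)).le
  refine ⟨(x - k * φ, y), ⟨_, hy, ?_⟩, π_eq_π_iff.2 ⟨k, 0, by simp⟩⟩
  rw [segment_eq_image']
  refine ⟨(x - k * φ) / φ, ⟨div_nonneg (by linarith) φ_pos.le,
    (div_le_one φ_pos).2 (by linarith)⟩, ?_⟩
  simp [div_mul_cancel₀ _ φ_pos.ne']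

theorem R₀_π_mem_image_Δ_iff {x : ℝ} (hx : x ∉ intAdjoinφ) (n : ℤ × ℤ) :
    R₀ n (π (x, 0)) ∈ π '' Δ ↔ n.2 = 0 ∨ n.2 = 1 := by
  rw [R₀_π]
  constructor
  · rintro ⟨v, hv, hvn⟩
    obtain ⟨a, b, rfl⟩ := π_eq_π_iff.1 hvn.symm
    have h₁ : ((x, (0 : ℝ)) + ι n + (a * φ + b, b * (φ + 3))).1 ∉ intAdjoinφ := fun h => hx <| by
      convert sub_mem h (int_combination_mem (n.1 + b) a) using 1
      simp [ι]
      ring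
    have h₂ : ((x, (0 : ℝ)) + ι n + (a * φ + b, b * (φ + 3))).2 = ((n.2 + 3 * b : ℤ) : ℝ) + b * φ := by
      simp [ι]
      ring
    rcases snd_eq_zero_or_one_of_mem_Δ hv h₁ (h₂ ▸ int_combination_mem _ _) with h | h <;>
      rw [h₂] at h
    · have := int_combination_φ_eq_zero h
      omega
    · have := @int_combination_φ_eq_zero (n.2 + 3 * b - 1) b (by push_cast at h ⊢; linarith)
      omega
  · rintro (h | h)
    · convert π_mem_image_Δ_of_horizontal (x + n.1) (y := 0) (by simp [ΔLines]) using 2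
      simp [ι, h]
    · convert π_mem_image_Δ_of_horizontal (x + n.1) (y := 1) (by simp [ΔLines]) using 2
      simp [ι, h]

theorem mech_eq_zero_or_one {α : ℝ} (h₀ : 0 ≤ α) (h₁ : α ≤ 1) (ρ : ℝ) (n : ℤ) :
    mech α ρ n = 0 ∨ mech α ρ n = 1 := by
  have hlo : ⌊α * n + ρ⌋ ≤ ⌊α * (n + 1) + ρ⌋ := Int.floor_mono (by linarith)
  have hhi : ⌊α * (n + 1) + ρ⌋ ≤ ⌊α * n + ρ⌋ + 1 := by
    rw [← Int.floor_add_one]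
    exact Int.floor_mono (by linarith)
  rw [mech]
  omega

/-- Statement: the structure of the Conway worm through a point p of T lying on the horizontal Δ-line from (0,0) to (φ,0), not in the R₀-orbit of 0, is given by the sturmian sequence encoded by the mechanical sets H_{α,ρ} and V_{α,ρ} with α = 2−φ and ρ = dist(p,P)/φ. -/
theorem conway_worm_slope_zero
    (q : ℝ × ℝ) (hq : q ∈ segment ℝ ((0 : ℝ), (0 : ℝ)) (φ, (0 : ℝ)))
    (p : T) (hp : p = π q)
    (horb : ∀ n : ℤ × ℤ, p ≠ π (ι n))
    (ρ : ℝ) (hρ : ρ = dist q (((0 : ℝ), (0 : ℝ)) : ℝ × ℝ) / φ) :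
    {n : ℤ × ℤ | R₀ n p ∈ π '' Δ} =
      {n : ℤ × ℤ | ∃ a ∈ Hset (2 - φ) ρ, ∃ s ∈ suppB₀, n = ((1) * a.1 + (0) * a.2 + s.1, (0) * a.1 + (0) * a.2 + s.2)} ∪
      {n : ℤ × ℤ | ∃ a ∈ Vset (2 - φ) ρ, ∃ s ∈ suppG₀, n = ((1) * a.1 + (0) * a.2 + s.1, (0) * a.1 + (0) * a.2 + s.2)} := by
  have hα₀ : (0 : ℝ) ≤ 2 - φ := sub_nonneg.2 Real.goldenRatio_lt_two.le
  have hα₁ : 2 - φ ≤ 1 := by linarith [φ_eq_goldenRatio, Real.one_lt_goldenRatio]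
  obtain ⟨x, rfl⟩ : ∃ x : ℝ, q = (x, 0) := by
    rw [segment_eq_image'] at hq
    obtain ⟨t, -, rfl⟩ := hq
    exact ⟨t * φ, by simp⟩
  have hx : x ∉ intAdjoinφ := fun h => by
    obtain ⟨a, b, rfl⟩ := exists_int_combination h
    exact horb (a, 0) (hp.trans (π_eq_π_iff.2 ⟨-b, 0, by simp [ι]⟩))
  subst hp
  ext n
  simp only [Set.mem_ofPred_eq, Set.mem_union, R₀_π_mem_image_Δ_iff hx]
  constructor
  · intro h
    have hs : ((0 : ℤ), n.2) ∈ suppB₀ := by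
      rcases h with h | h <;> simp [suppB₀, h]
    exact (mech_eq_zero_or_one hα₀ hα₁ ρ n.1).imp
      (fun hm => ⟨(n.1, ⌊(2 - φ) * n.1 + ρ⌋), ⟨rfl, hm⟩, _, hs, by simp⟩)
      (fun hm => ⟨(n.1, ⌊(2 - φ) * n.1 + ρ⌋), ⟨rfl, hm⟩, _, hs, by simp⟩)
  · rintro (⟨a, -, s, rfl | rfl, rfl⟩ | ⟨a, -, s, rfl | rfl, rfl⟩) <;> simp

end JeandelRao
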